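/- arXiv:math/0403191 — 2 statements merged into one kernel-verified Lean document; each statement's English description precedes it below -/
import Mathlib

section
/- The family 𝒥 = {J_W : W a weak order on X} of subsets of the finite set of weak 2-orders on X is well graded: for any weak orders W and W' on X, there exists a sequence of weak orders W = W_0, W_1, …, W_k = W' with k = |J_W Δ J_{W'}| such that |J_{W_i} Δ J_{W_{i+1}}| = 1 for all 0 ≤ i < k. (This says that the correspondence W ↦ J_W is an isometric embedding of the graph of the Hasse diagram of the weak orders into the graph of a hypercube, i.e., this graph is a partial cube.) -/
/-- A weak order on `X`: a transitive and strongly complete binary relation,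
represented as a set of pairs. -/
def IsWeakOrder {X : Type*} (W : Set (X × X)) : Prop :=
  (∀ x y z : X, (x, y) ∈ W → (y, z) ∈ W → (x, z) ∈ W) ∧
  (∀ x y : X, (x, y) ∈ W ∨ (y, x) ∈ W)

/-- The set of indifference classes of a relation `W`, i.e. the equivalence
classes of the indifference relation `I_W = W ∩ W⁻¹`. -/
def IndiffClasses {X : Type*} (W : Set (X × X)) : Set (Set X) :=
  {C | ∃ x : X, C = {y | (x, y) ∈ W ∧ (y, x) ∈ W}}

/-- A weak 2-order: a weak order with exactly two indifference classes. -/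
def IsWeak2Order {X : Type*} (W : Set (X × X)) : Prop :=
  IsWeakOrder W ∧ (IndiffClasses W).ncard = 2

/-- `JW W` is the set of all weak 2-orders containing `W`. -/
def JW {X : Type*} (W : Set (X × X)) : Set (Set (X × X)) :=
  {V | IsWeak2Order V ∧ W ⊆ V}

/-- The relation with upper class `A` and lower class `Aᶜ`. -/
def cutRel {X : Type*} (A : Set X) : Set (X × X) :=
  {p | p.1 ∈ A → p.2 ∈ A}

theorem isWeakOrder_cutRel {X : Type*} (A : Set X) : IsWeakOrder (cutRel A) := by
  refine ⟨fun x y z hxy hyz hx => hyz (hxy hx), fun x y => ?_⟩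
  simp only [cutRel, Set.mem_ofPred_eq]
  tauto

theorem isWeak2Order_cutRel {X : Type*} {A : Set X} {a b : X} (ha : a ∈ A) (hb : b ∉ A) :
    IsWeak2Order (cutRel A) := by
  refine ⟨isWeakOrder_cutRel A, ?_⟩
  have hclass : IndiffClasses (cutRel A) = {A, Aᶜ} := by
    ext C
    simp only [IndiffClasses, cutRel, Set.mem_ofPred_eq, Set.mem_insert_iff,
      Set.mem_singleton_iff]
    constructor
    · rintro ⟨x, rfl⟩
      by_cases hx : x ∈ A
      · left; ext y; simp [hx]
      · right; ext y; simp [hx]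
    · rintro (rfl | rfl)
      · exact ⟨a, by ext y; simp [ha]⟩
      · exact ⟨b, by ext y; simp [hb]⟩
  rw [hclass]
  refine Set.ncard_pair fun h => ?_
  have : a ∈ Aᶜ := h ▸ ha
  exact this ha

theorem IsWeak2Order.exists_eq_cutRel {X : Type*} {V : Set (X × X)} (hV : IsWeak2Order V) :
    ∃ A : Set X, A.Nonempty ∧ Aᶜ.Nonempty ∧ V = cutRel A := by
  obtain ⟨⟨htrans, htotal⟩, hcard⟩ := hV
  obtain ⟨C, D, hCD, hclass⟩ := Set.ncard_eq_two.mp hcard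
  obtain ⟨c, hc⟩ : C ∈ IndiffClasses V := by simp [hclass]
  obtain ⟨d, hd⟩ : D ∈ IndiffClasses V := by simp [hclass]
  have hrefl : ∀ x, (x, x) ∈ V := fun x => (htotal x x).elim id id
  have hcases : ∀ x, ((c, x) ∈ V ∧ (x, c) ∈ V) ∨ ((d, x) ∈ V ∧ (x, d) ∈ V) := by
    intro x
    have hx : {y | (x, y) ∈ V ∧ (y, x) ∈ V} ∈ IndiffClasses V := ⟨x, rfl⟩
    have hxx : x ∈ {y | (x, y) ∈ V ∧ (y, x) ∈ V} := ⟨hrefl x, hrefl x⟩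
    rw [hclass] at hx
    rcases hx with h | h
    · left; rw [h, hc] at hxx; exact hxx
    · right; rw [Set.mem_singleton_iff.mp h, hd] at hxx; exact hxx
  have hne : ¬((c, d) ∈ V ∧ (d, c) ∈ V) := by
    rintro ⟨hcd, hdc⟩
    refine hCD ?_
    rw [hc, hd]
    ext y
    exact ⟨fun h => ⟨htrans _ _ _ hdc h.1, htrans _ _ _ h.2 hcd⟩,
      fun h => ⟨htrans _ _ _ hcd h.1, htrans _ _ _ h.2 hdc⟩⟩
  have key : ∀ c d : X, (∀ x, ((c, x) ∈ V ∧ (x, c) ∈ V) ∨ ((d, x) ∈ V ∧ (x, d) ∈ V)) →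
      (c, d) ∈ V → (d, c) ∉ V → ∃ A : Set X, A.Nonempty ∧ Aᶜ.Nonempty ∧ V = cutRel A := by
    intro c d hcases hcd hdc
    refine ⟨{z | (d, z) ∈ V}, ⟨d, hrefl d⟩, ⟨c, hdc⟩, ?_⟩
    ext ⟨x, y⟩
    refine ⟨fun h hx => htrans _ _ _ hx h, fun h => ?_⟩
    have h' : (d, x) ∈ V → (d, y) ∈ V := h
    rcases hcases x with hx | hx
    · rcases hcases y with hy | hy
      · exact htrans _ _ _ hx.2 hy.1
      · exact htrans _ _ _ hx.2 (htrans _ _ _ hcd hy.1)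
    · exact htrans _ _ _ hx.2 (h' hx.1)
  rcases htotal c d with h | h
  · exact key c d hcases h fun h' => hne ⟨h, h'⟩
  · exact key d c (fun x => (hcases x).symm) h fun h' => hne ⟨h', h⟩

theorem IsWeakOrder.sInter_JW {X : Type*} {W : Set (X × X)} (hW : IsWeakOrder W) :
    ⋂₀ JW W = W := by
  refine Set.Subset.antisymm ?_ (Set.subset_sInter fun V hV => hV.2)
  rintro ⟨x, y⟩ hxy
  by_contra hn
  have hxx : (x, x) ∈ W := (hW.2 x x).elim id id
  have hmem : cutRel {z | (x, z) ∈ W} ∈ JW W :=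
    ⟨isWeak2Order_cutRel (a := x) (b := y) hxx hn, fun p hp hx => hW.1 _ _ _ hx hp⟩
  exact hn (hxy _ hmem hxx)

/-- In a finite weak order every nonempty set has a least element. -/
theorem IsWeakOrder.exists_least {X : Type*} [Finite X] {W : Set (X × X)}
    (hW : IsWeakOrder W) {B : Set X} (hB : B.Nonempty) :
    ∃ x ∈ B, ∀ b ∈ B, (x, b) ∈ W := by
  induction B, B.toFinite using Set.Finite.induction_on with
  | empty => exact absurd hB Set.not_nonempty_empty
  | @insert a s _ _ ih =>
    have haa : (a, a) ∈ W := (hW.2 a a).elim id id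
    rcases s.eq_empty_or_nonempty with rfl | hs
    · exact ⟨a, by simp, by simpa using haa⟩
    · obtain ⟨x, hx, hmin⟩ := ih hs
      rcases hW.2 a x with h | h
      · refine ⟨a, Set.mem_insert _ _, ?_⟩
        rintro b (rfl | hb)
        · exact haa
        · exact hW.1 _ _ _ h (hmin b hb)
      · refine ⟨x, Set.mem_insert_of_mem _ hx, ?_⟩
        rintro b (rfl | hb)
        · exact h
        · exact hmin b hb

theorem IsWeakOrder.exists_greatest {X : Type*} [Finite X] {W : Set (X × X)}
    (hW : IsWeakOrder W) {B : Set X} (hB : B.Nonempty) :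
    ∃ x ∈ B, ∀ b ∈ B, (b, x) ∈ W :=
  IsWeakOrder.exists_least (W := {p | (p.2, p.1) ∈ W})
    ⟨fun _ _ _ hxy hyz => hW.1 _ _ _ hyz hxy, fun x y => hW.2 y x⟩ hB

theorem IsWeakOrder.sInter {X : Type*} {W : Set (X × X)} (hW : IsWeakOrder W)
    {S : Set (Set (X × X))} (hS : S ⊆ JW W) : IsWeakOrder (⋂₀ S) :=
  ⟨fun x y z hxy hyz V hV => (hS hV).1.1.1 x y z (hxy V hV) (hyz V hV),
    fun x y => (hW.2 x y).imp (fun h _ hV => (hS hV).2 h) fun h _ hV => (hS hV).2 h⟩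

theorem IsWeakOrder.JW_sInter {X : Type*} [Finite X] {W : Set (X × X)} (hW : IsWeakOrder W)
    {S : Set (Set (X × X))} (hS : S ⊆ JW W) : JW (⋂₀ S) = S := by
  refine Set.Subset.antisymm ?_ fun V hV => ⟨(hS hV).1, Set.sInter_subset_of_mem hV⟩
  rintro V ⟨hV, hSV⟩
  have hWV : W ⊆ V := (Set.subset_sInter fun U hU => (hS hU).2).trans hSV
  obtain ⟨B, hB, hBc, rfl⟩ := hV.exists_eq_cutRel
  obtain ⟨x, hx, hmin⟩ := hW.exists_least hB
  obtain ⟨y, hy, hmax⟩ := hW.exists_greatest hBc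
  have hxy : (x, y) ∉ ⋂₀ S := fun h => hy (hSV h hx)
  simp only [Set.mem_sInter, not_forall] at hxy
  obtain ⟨U, hU, hxyU⟩ := hxy
  obtain ⟨hU2, hWU⟩ := hS hU
  obtain ⟨A, -, -, rfl⟩ := hU2.exists_eq_cutRel
  have hxA : x ∈ A ∧ y ∉ A := by simpa [cutRel] using hxyU
  have hAB : A = B := by
    ext b
    refine ⟨fun hb => ?_, fun hb => hWU (hmin b hb) hxA.1⟩
    by_contra hbB
    exact hxA.2 (hWU (hmax b hbB) hb)
  exact hAB ▸ hU

/-- One step from `W` towards `W'`: some element on which `JW W` and `JW W'` differ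
can be toggled. -/
theorem IsWeakOrder.exists_step {X : Type*} [Finite X] {W W' : Set (X × X)}
    (hW : IsWeakOrder W) (hW' : IsWeakOrder W') (h : (symmDiff (JW W) (JW W')).Nonempty) :
    ∃ V ∈ symmDiff (JW W) (JW W'), ∃ U, IsWeakOrder U ∧ JW U = symmDiff (JW W) {V} := by
  by_cases hsub : JW W ⊆ JW W'
  · obtain ⟨V, hV⟩ := h
    have hV' : V ∈ JW W' ∧ V ∉ JW W := hV.resolve_left fun h => h.2 (hsub h.1)
    have hS : symmDiff (JW W) {V} ⊆ JW W' := by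
      rintro U (hU | hU)
      · exact hsub hU.1
      · exact Set.mem_singleton_iff.mp hU.1 ▸ hV'.1
    exact ⟨V, hV, ⋂₀ symmDiff (JW W) {V}, hW'.sInter hS, hW'.JW_sInter hS⟩
  · obtain ⟨V, hV, hV'⟩ := Set.not_subset.mp hsub
    have hS : symmDiff (JW W) {V} ⊆ JW W := by
      rintro U (hU | hU)
      · exact hU.1
      · exact Set.mem_singleton_iff.mp hU.1 ▸ hV
    exact ⟨V, Or.inl ⟨hV, hV'⟩, ⋂₀ symmDiff (JW W) {V}, hW.sInter hS, hW.JW_sInter hS⟩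

theorem exists_path_of_ncard_symmDiff_JW {X : Type*} [Finite X] (W' : Set (X × X))
    (hW' : IsWeakOrder W') (k : ℕ) :
    ∀ W : Set (X × X), IsWeakOrder W → (symmDiff (JW W) (JW W')).ncard = k →
      ∃ f : Fin (k + 1) → Set (X × X),
        f 0 = W ∧ f (Fin.last k) = W' ∧ (∀ i, IsWeakOrder (f i)) ∧
        ∀ i : Fin k, (symmDiff (JW (f i.castSucc)) (JW (f i.succ))).ncard = 1 := by
  induction k with
  | zero =>
    intro W hW hk
    have hJ : JW W = JW W' := symmDiff_eq_bot.mp ((Set.ncard_eq_zero).mp hk)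
    have hWW' : W = W' := by rw [← hW.sInter_JW, hJ, hW'.sInter_JW]
    exact ⟨fun _ => W, rfl, hWW', fun _ => hW, fun i => i.elim0⟩
  | succ k ih =>
    intro W hW hk
    obtain ⟨V, hV, U, hU, hJU⟩ :=
      hW.exists_step hW' (Set.nonempty_of_ncard_ne_zero (by omega))
    have hdiff : symmDiff (JW U) (JW W') = symmDiff (JW W) (JW W') \ {V} := by
      rw [hJU]
      ext T
      by_cases hT : T = V
      · subst hT
        simp only [Set.mem_symmDiff, Set.mem_sdiff, Set.mem_singleton_iff] at hV ⊢
        tauto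
      · simp [Set.mem_symmDiff, hT]
    obtain ⟨f, hf0, hfk, hf, hstep⟩ := ih U hU (by
      rw [hdiff, Set.ncard_sdiff_singleton_of_mem hV, hk, Nat.add_sub_cancel])
    refine ⟨Fin.cons W f, rfl, ?_, Fin.cases hW hf, Fin.cases ?_ fun i => ?_⟩
    · rw [← Fin.succ_last, Fin.cons_succ, hfk]
    · rw [Fin.castSucc_zero, Fin.cons_zero, Fin.cons_succ, hf0, hJU, symmDiff_symmDiff_cancel_left,
        Set.ncard_singleton]
    · rw [← Fin.succ_castSucc, Fin.cons_succ, Fin.cons_succ]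
      exact hstep i

/-- the family `𝒥 = {J_W}` is well graded: between any two weak
orders there is a path of weak orders along which `J` changes by one element at
a time, of length `|J_W Δ J_{W'}|`. -/
theorem JW_well_graded {X : Type*} [Fintype X]
    (W W' : Set (X × X)) (hW : IsWeakOrder W) (hW' : IsWeakOrder W') :
    ∃ (k : ℕ) (f : Fin (k + 1) → Set (X × X)),
      k = (symmDiff (JW W) (JW W')).ncard ∧
      f 0 = W ∧ f (Fin.last k) = W' ∧
      (∀ i : Fin (k + 1), IsWeakOrder (f i)) ∧
      (∀ i : Fin k, (symmDiff (JW (f i.castSucc)) (JW (f i.succ))).ncard = 1) := by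
  obtain ⟨f, hf⟩ := exists_path_of_ncard_symmDiff_JW W' hW' _ W hW rfl
  exact ⟨_, f, rfl, hf⟩
end

section
/- Let X be a finite set, let W be a weak order on X and let V be a weak 2-order on X with W ⊆ V. Then W' := ⋂ {U : U a weak 2-order on X with W ⊆ U and U ≠ V} (equal to X × X if this family is empty) is a weak order on X that covers W in the inclusion order: W ⊊ W' and no weak order lies strictly between W and W'. Moreover J_{W'} = J_W \ {V}. -/
/-- The relation ranking the elements of `A` weakly above all others. -/
def cutOrder {X : Type*} (A : Set X) : Set (X × X) :=
  {p | p.2 ∈ A → p.1 ∈ A}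

theorem mem_cutOrder {X : Type*} {A : Set X} {x y : X} :
    (x, y) ∈ cutOrder A ↔ (y ∈ A → x ∈ A) := Iff.rfl

theorem IsWeakOrder.refl {X : Type*} {W : Set (X × X)} (hW : IsWeakOrder W) (x : X) :
    (x, x) ∈ W := (hW.2 x x).elim id id

theorem isWeak2Order_cutOrder {X : Type*} {A : Set X} {a b : X} (ha : a ∈ A) (hb : b ∉ A) :
    IsWeak2Order (cutOrder A) := by
  refine ⟨⟨fun x y z => ?_, fun x y => ?_⟩, ?_⟩
  · simp only [mem_cutOrder]
    tauto
  · simp only [mem_cutOrder]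
    tauto
  · have h : IndiffClasses (cutOrder A) = {A, Aᶜ} := by
      ext C
      simp only [IndiffClasses, mem_cutOrder, Set.mem_ofPred_eq, Set.mem_insert_iff,
        Set.mem_singleton_iff]
      constructor
      · rintro ⟨x, rfl⟩
        by_cases hx : x ∈ A
        · left
          ext y
          simp [hx]
        · right
          ext y
          simp [hx]
      · rintro (rfl | rfl)
        · refine ⟨a, ?_⟩
          ext y
          simp [ha]
        · refine ⟨b, ?_⟩
          ext y
          simp [hb]
    rw [h]
    refine Set.ncard_pair fun h => ?_
    rw [h] at ha
    exact ha (h ▸ ha)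

theorem IsWeakOrder.eq_cutOrder {X : Type*} {U : Set (X × X)} (hU : IsWeakOrder U) {a b : X}
    (hba : (b, a) ∉ U)
    (h : ∀ x, ((x, a) ∈ U ∧ (a, x) ∈ U) ∨ ((x, b) ∈ U ∧ (b, x) ∈ U)) :
    U = cutOrder {z | (z, a) ∈ U} := by
  obtain ⟨ht, hc⟩ := hU
  ext ⟨x, y⟩
  refine ⟨fun hxy hy => ht _ _ _ hxy hy, fun hxy => ?_⟩
  by_contra hn
  have hyx := (hc x y).resolve_left hn
  change (y, a) ∈ U → (x, a) ∈ U at hxy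
  rcases h x with hx | hx <;> rcases h y with hy | hy
  · exact hn (ht _ _ _ hx.1 hy.2)
  · exact hba (ht _ _ _ hy.2 (ht _ _ _ hyx hx.1))
  · exact hba (ht _ _ _ hx.2 (hxy hy.1))
  · exact hn (ht _ _ _ hx.1 hy.2)

theorem IsWeak2Order.exists_eq_cutOrder {X : Type*} {U : Set (X × X)} (hU : IsWeak2Order U) :
    ∃ A : Set X, A.Nonempty ∧ Aᶜ.Nonempty ∧ U = cutOrder A := by
  obtain ⟨hw, h2⟩ := hU
  obtain ⟨C, D, hCD, h⟩ := Set.ncard_eq_two.1 h2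
  obtain ⟨a, rfl⟩ : C ∈ IndiffClasses U := by simp [h]
  obtain ⟨b, rfl⟩ : D ∈ IndiffClasses U := by simp [h]
  have hx : ∀ x, ((x, a) ∈ U ∧ (a, x) ∈ U) ∨ ((x, b) ∈ U ∧ (b, x) ∈ U) := by
    intro x
    have hmem : {y | (x, y) ∈ U ∧ (y, x) ∈ U} ∈ IndiffClasses U := ⟨x, rfl⟩
    have hself : x ∈ {y | (x, y) ∈ U ∧ (y, x) ∈ U} := ⟨hw.refl x, hw.refl x⟩
    rw [h] at hmem
    rcases hmem with he | he <;> rw [he] at hself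
    · exact Or.inl hself.symm
    · exact Or.inr hself.symm
  by_cases hba : (b, a) ∈ U
  · have hab : (a, b) ∉ U := by
      intro hab
      apply hCD
      ext y
      exact ⟨fun hy => ⟨hw.1 _ _ _ hba hy.1, hw.1 _ _ _ hy.2 hab⟩,
        fun hy => ⟨hw.1 _ _ _ hab hy.1, hw.1 _ _ _ hy.2 hba⟩⟩
    exact ⟨_, ⟨b, hw.refl b⟩, ⟨a, hab⟩, hw.eq_cutOrder hab fun x => (hx x).symm⟩
  · exact ⟨_, ⟨a, hw.refl a⟩, ⟨b, hba⟩, hw.eq_cutOrder hba hx⟩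

theorem IsWeakOrder.exists_isWeak2Order_notMem {X : Type*} {W : Set (X × X)}
    (hW : IsWeakOrder W) {x y : X} (hxy : (x, y) ∉ W) :
    ∃ U, IsWeak2Order U ∧ W ⊆ U ∧ (x, y) ∉ U :=
  ⟨cutOrder {z | (z, y) ∈ W}, isWeak2Order_cutOrder (hW.refl y) hxy,
    fun p hp hy => hW.1 p.1 p.2 y hp hy, fun h => hxy (h (hW.refl y))⟩

theorem Set.Finite.exists_forall_rel {X : Type*} {r : X → X → Prop}
    (ht : ∀ x y z, r x y → r y z → r x z) (hc : ∀ x y, r x y ∨ r y x)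
    {s : Set X} (hs : s.Finite) (hne : s.Nonempty) : ∃ x ∈ s, ∀ z ∈ s, r x z := by
  induction s, hs using Set.Finite.induction_on with
  | empty => simp at hne
  | @insert a s _ _ ih =>
    have hr (x : X) : r x x := (hc x x).elim id id
    rcases s.eq_empty_or_nonempty with rfl | hs
    · exact ⟨a, by simp, by simp [hr]⟩
    obtain ⟨x, hxs, hx⟩ := ih hs
    rcases hc a x with h | h
    · exact ⟨a, Or.inl rfl, Set.forall_mem_insert.2 ⟨hr a, fun z hz => ht _ _ _ h (hx z hz)⟩⟩
    · exact ⟨x, Or.inr hxs, Set.forall_mem_insert.2 ⟨h, hx⟩⟩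

theorem isWeakOrder_sInter {X : Type*} {W : Set (X × X)} (hW : IsWeakOrder W)
    {F : Set (Set (X × X))} (hF : ∀ U ∈ F, IsWeakOrder U ∧ W ⊆ U) :
    IsWeakOrder (⋂₀ F) :=
  ⟨fun x y z hxy hyz U hU => (hF U hU).1.1 x y z (hxy U hU) (hyz U hU),
    fun x y => (hW.2 x y).imp (fun h U hU => (hF U hU).2 h) (fun h U hU => (hF U hU).2 h)⟩

theorem IsWeakOrder.exists_notMem_forall_mem_of_ne {X : Type*} [Finite X] {W V : Set (X × X)}
    (hW : IsWeakOrder W) (hV : IsWeak2Order V) :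
    ∃ p ∉ V, ∀ U, IsWeak2Order U → W ⊆ U → U ≠ V → p ∈ U := by
  obtain ⟨A, hA, hA', rfl⟩ := hV.exists_eq_cutOrder
  obtain ⟨y, hyA, hy⟩ := A.toFinite.exists_forall_rel (r := fun x z => (z, x) ∈ W)
    (fun x y z hxy hyz => hW.1 z y x hyz hxy) (fun x y => hW.2 y x) hA
  obtain ⟨x, hxA, hx⟩ := Aᶜ.toFinite.exists_forall_rel (r := fun x z => (x, z) ∈ W)
    hW.1 hW.2 hA'
  refine ⟨(x, y), fun h => hxA (h hyA), fun U hU hWU hne => ?_⟩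
  obtain ⟨B, -, -, rfl⟩ := hU.exists_eq_cutOrder
  intro hyB
  by_contra hxB
  refine hne (congrArg cutOrder (Set.Subset.antisymm (fun z hzB => ?_) fun z hzA => ?_))
  · by_contra hzA
    exact hxB (mem_cutOrder.1 (hWU (hx z hzA)) hzB)
  · exact mem_cutOrder.1 (hWU (hy z hzA)) hyB

/-- if `W` is a weak order and `V ∈ J_W` a weak 2-order, then the
intersection of all weak 2-orders containing `W` other than `V` is a weak order
covering `W`, and its `J`-set is `J_W \ {V}`. -/
theorem removing_weak2order_covers {X : Type*} [Fintype X]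
    (W V : Set (X × X)) (hW : IsWeakOrder W) (hV : IsWeak2Order V)
    (hWV : W ⊆ V) :
    IsWeakOrder (⋂₀ {U : Set (X × X) | IsWeak2Order U ∧ W ⊆ U ∧ U ≠ V}) ∧
    W ⊂ ⋂₀ {U : Set (X × X) | IsWeak2Order U ∧ W ⊆ U ∧ U ≠ V} ∧
    (¬∃ W'' : Set (X × X), IsWeakOrder W'' ∧ W ⊂ W'' ∧
      W'' ⊂ ⋂₀ {U : Set (X × X) | IsWeak2Order U ∧ W ⊆ U ∧ U ≠ V}) ∧
    JW (⋂₀ {U : Set (X × X) | IsWeak2Order U ∧ W ⊆ U ∧ U ≠ V}) = JW W \ {V} := by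
  obtain ⟨p, hpV, hp⟩ := hW.exists_notMem_forall_mem_of_ne hV
  refine ⟨isWeakOrder_sInter hW fun U hU => ⟨hU.1.1, hU.2.1⟩,
    ⟨fun q hq U hU => hU.2.1 hq, fun h => ?_⟩, ?_, ?_⟩
  · exact hpV (hWV (h fun U hU => hp U hU.1 hU.2.1 hU.2.2))
  · rintro ⟨W'', hW'', hlt, hlt'⟩
    by_cases hVW : W'' ⊆ V
    · refine hlt.2 fun q hq => ?_
      by_contra hqW
      obtain ⟨U, hU, hWU, hqU⟩ := hW.exists_isWeak2Order_notMem hqW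
      by_cases hUV : U = V
      · exact hqU (hUV ▸ hVW hq)
      · exact hqU (hlt'.1 hq U ⟨hU, hWU, hUV⟩)
    · refine hlt'.2 fun q hq => ?_
      by_contra hqW
      obtain ⟨U, hU, hWU, hqU⟩ := hW''.exists_isWeak2Order_notMem hqW
      exact hqU (hq U ⟨hU, hlt.1.trans hWU, fun h => hVW (h ▸ hWU)⟩)
  · ext U
    constructor
    · rintro ⟨hU, hsub⟩
      refine ⟨⟨hU, fun q hq => hsub fun T hT => hT.2.1 hq⟩, ?_⟩
      rintro rfl
      exact hpV (hsub fun T hT => hp T hT.1 hT.2.1 hT.2.2)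
    · rintro ⟨⟨hU, hWU⟩, hne⟩
      exact ⟨hU, Set.sInter_subset_of_mem ⟨hU, hWU, hne⟩⟩
end
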